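/- Let p, q, r, s ∈ ℝ with r ≠ s. Then the curve α₁ : ℝ → ℝ⁴ defined by α₁(ξ) = (1/(4(s−r))) · ( (p−s)e^{(p−r)ξ} + (r−q)e^{(q−s)ξ}, (p−r)e^{(p−s)ξ} + (q−s)e^{(q−r)ξ}, (p−s)e^{(p−r)ξ} − (r−q)e^{(q−s)ξ}, (p−r)e^{(p−s)ξ} − (q−s)e^{(q−r)ξ} ) is a null curve in E⁴₂. -/

import Mathlib

/-- The derivative of a linear combination of two exponentials, divided by a constant. -/
theorem deriv_exp_add_exp_div (a b c d k x : ℝ) :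
    deriv (fun t => (a * Real.exp (b * t) + c * Real.exp (d * t)) / k) x =
      (a * b * Real.exp (b * x) + c * d * Real.exp (d * x)) / k := by
  have h (e : ℝ) : HasDerivAt (fun t => Real.exp (e * t)) (Real.exp (e * x) * e) x := by
    simpa using ((hasDerivAt_id x).const_mul e).exp
  rw [((((h b).const_mul a).fun_add ((h d).const_mul c)).div_const k).deriv]
  ring

/-- The derivative of a difference of two exponentials with coefficients, divided by a constant. -/
theorem deriv_exp_sub_exp_div (a b c d k x : ℝ) :
    deriv (fun t => (a * Real.exp (b * t) - c * Real.exp (d * t)) / k) x =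
      (a * b * Real.exp (b * x) - c * d * Real.exp (d * x)) / k := by
  simpa [sub_eq_add_neg] using deriv_exp_add_exp_div a b (-c) d k x


/-- The curve
`α₁(ξ) = (1/(4(s−r)))·((p−s)e^{(p−r)ξ} + (r−q)e^{(q−s)ξ}, (p−r)e^{(p−s)ξ} + (q−s)e^{(q−r)ξ},
(p−s)e^{(p−r)ξ} − (r−q)e^{(q−s)ξ}, (p−r)e^{(p−s)ξ} − (q−s)e^{(q−r)ξ})`
is a null curve in `E⁴₂`. -/
theorem stmt14 (p q r s : ℝ) (hrs : r ≠ s) :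
    ∀ ξ : ℝ,
      (deriv (fun t => ((p - s) * Real.exp ((p - r) * t) +
        (r - q) * Real.exp ((q - s) * t)) / (4 * (s - r))) ξ) ^ 2 +
      (deriv (fun t => ((p - r) * Real.exp ((p - s) * t) +
        (q - s) * Real.exp ((q - r) * t)) / (4 * (s - r))) ξ) ^ 2 -
      (deriv (fun t => ((p - s) * Real.exp ((p - r) * t) -
        (r - q) * Real.exp ((q - s) * t)) / (4 * (s - r))) ξ) ^ 2 -
      (deriv (fun t => ((p - r) * Real.exp ((p - s) * t) -
        (q - s) * Real.exp ((q - r) * t)) / (4 * (s - r))) ξ) ^ 2 = 0 := by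
  intro ξ
  simp only [deriv_exp_add_exp_div, deriv_exp_sub_exp_div]
  have h : Real.exp ((p - r) * ξ) * Real.exp ((q - s) * ξ) =
      Real.exp ((p - s) * ξ) * Real.exp ((q - r) * ξ) := by
    rw [← Real.exp_add, ← Real.exp_add]
    ring_nf
  linear_combination
    4 * (p - s) * (p - r) * (r - q) * (q - s) * ((4 * (s - r))⁻¹) ^ 2 * h
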